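/- For every integer n ≥ 4, the polynomial f_n = x³ + y³ + z³ − 3xyz + zⁿ ∈ ℂ[x,y,z] has an isolated critical point at the origin, and its Milnor number is μ(f_n) = 3n − 1. -/

import Mathlib

open MvPolynomial

/-- The Milnor number of a polynomial `F ∈ ℂ[x,y,z]`: the `ℂ`-dimension of the quotient of the
formal power series ring `ℂ⟦x,y,z⟧` by the ideal generated by the three partial derivatives. -/
noncomputable def milnorNumber (F : MvPolynomial (Fin 3) ℂ) : ℕ :=
  Module.finrank ℂ (MvPowerSeries (Fin 3) ℂ ⧸
    Ideal.span (Set.range fun i : Fin 3 => (pderiv i F).toMvPowerSeries))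

/-- `F` has a critical point at the origin of `ℂ³`, and it is isolated. -/
def HasIsolatedCriticalPointAtOrigin (F : MvPolynomial (Fin 3) ℂ) : Prop :=
  (∀ i, eval (0 : Fin 3 → ℂ) (pderiv i F) = 0) ∧
  ∃ ε > (0 : ℝ), ∀ p : Fin 3 → ℂ, ‖p‖ < ε → (∀ i, eval p (pderiv i F) = 0) → p = 0

namespace CubicPlusPow

/-- The polynomial `x³ + y³ + z³ − 3xyz + zⁿ`. -/
noncomputable def poly (n : ℕ) : MvPolynomial (Fin 3) ℂ :=
  X 0 ^ 3 + X 1 ^ 3 + X 2 ^ 3 - 3 * X 0 * X 1 * X 2 + X 2 ^ n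

lemma pderiv_three (i : Fin 3) : pderiv i (3 : MvPolynomial (Fin 3) ℂ) = 0 :=
  pderiv_C (a := (3 : ℂ))

lemma pderiv_zero_poly (n : ℕ) : pderiv 0 (poly n) = 3 * X 0 ^ 2 - 3 * (X 1 * X 2) := by
  simp [poly, pderiv_X, pderiv_three]
  ring

lemma pderiv_one_poly (n : ℕ) : pderiv 1 (poly n) = 3 * X 1 ^ 2 - 3 * (X 0 * X 2) := by
  simp [poly, pderiv_X, pderiv_three]
  ring

lemma pderiv_two_poly (n : ℕ) :
    pderiv 2 (poly n) = 3 * X 2 ^ 2 - 3 * (X 0 * X 1) + (n : MvPolynomial (Fin 3) ℂ) * X 2 ^ (n - 1) := by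
  simp [poly, pderiv_X, pderiv_three]
  ring

lemma hasIsolatedCriticalPointAtOrigin_poly {n : ℕ} (hn : 4 ≤ n) :
    HasIsolatedCriticalPointAtOrigin (poly n) := by
  have hn0 : (n : ℂ) ≠ 0 := by exact_mod_cast (by omega : n ≠ 0)
  have hnpos : (0 : ℝ) < n := by exact_mod_cast (by omega : 0 < n)
  refine ⟨?_, 3 / n, by positivity, ?_⟩
  · intro i
    fin_cases i
    · simp [pderiv_zero_poly]
    · simp [pderiv_one_poly]
    · simp [pderiv_two_poly, show n - 1 ≠ 0 by omega]
  · intro p hp hcrit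
    have h0 := hcrit 0
    have h1 := hcrit 1
    have h2 := hcrit 2
    simp only [pderiv_zero_poly, pderiv_one_poly, pderiv_two_poly, map_sub, map_add, map_mul,
      map_pow, eval_X, map_ofNat, map_natCast] at h0 h1 h2
    replace h0 : p 0 ^ 2 = p 1 * p 2 := by linear_combination h0 / 3
    replace h1 : p 1 ^ 2 = p 0 * p 2 := by linear_combination h1 / 3
    have hz : p 2 = 0 := by
      by_contra hz
      have hx : p 0 * (p 0 ^ 3 - p 2 ^ 3) = 0 := by
        linear_combination (p 0 ^ 2 + p 1 * p 2) * h0 + p 2 ^ 2 * h1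
      rcases mul_eq_zero.1 hx with hx | hx
      · have hy : p 1 = 0 := by simpa [hx] using h1
        have hzn : p 2 ^ 2 * (3 + n * p 2 ^ (n - 3)) = 0 := by
          have : p 2 ^ (n - 1) = p 2 ^ 2 * p 2 ^ (n - 3) := by
            rw [← pow_add]; congr 1; omega
          rw [this, hx] at h2
          linear_combination h2
        have h3 : p 2 ^ (n - 3) = -3 / n := by
          have := (mul_eq_zero.1 hzn).resolve_left (pow_ne_zero 2 hz)
          field_simp
          linear_combination this
        have hlt : ‖p 2‖ < 3 / n := (norm_le_pi_norm p 2).trans_lt hp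
        have hle : ‖p 2‖ ^ (n - 3) ≤ ‖p 2‖ := by
          refine pow_le_of_le_one (norm_nonneg _) (hlt.le.trans ?_) (by omega)
          rw [div_le_one hnpos]
          exact_mod_cast (by omega : 3 ≤ n)
        have h4 : ‖p 2‖ ^ (n - 3) = 3 / n := by
          rw [← norm_pow, h3]; simp
        linarith
      · have hxy : p 0 * p 1 = p 2 ^ 2 := by
          apply mul_right_cancel₀ hz
          linear_combination hx - p 0 * h0
        rw [hxy] at h2
        have : (n : ℂ) * p 2 ^ (n - 1) = 0 := by linear_combination h2
        exact (mul_ne_zero hn0 (pow_ne_zero _ hz)) this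
    ext i
    fin_cases i
    · simpa [hz] using h0
    · simpa [hz] using h1
    · exact hz

/-- The exponents `(j, k)` of the basis `zᵏ` (`k ≤ n`), `x zᵏ`, `y zᵏ` (`k ≤ n - 2`)
of the Milnor algebra. -/
def basisIndex (n : ℕ) : Finset (Fin 3 × ℕ) :=
  Finset.univ ×ˢ Finset.range (n - 1) ∪ {(0, n - 1), (0, n)}

lemma mem_basisIndex {n : ℕ} {p : Fin 3 × ℕ} :
    p ∈ basisIndex n ↔ p.2 < n - 1 ∨ p = (0, n - 1) ∨ p = (0, n) := by
  simp [basisIndex]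
  tauto

lemma card_basisIndex {n : ℕ} (hn : 4 ≤ n) : (basisIndex n).card = 3 * n - 1 := by
  rw [basisIndex, Finset.card_union_of_disjoint, Finset.card_product, Finset.card_pair]
  · simp
    omega
  · simp only [ne_eq, Prod.mk.injEq, true_and]
    omega
  · simp

/-- The basis vector indexed by `p`, or zero when `p` is not in `basisIndex n`. -/
noncomputable def truncSingle (n : ℕ) (p : Fin 3 × ℕ) : Fin 3 × ℕ →₀ ℂ :=
  if p ∈ basisIndex n then Finsupp.single p 1 else 0

lemma truncSingle_eq_zero {n : ℕ} (hn : 4 ≤ n) {p : Fin 3 × ℕ} (h : n - 1 ≤ p.2)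
    (h' : p.1 = 0 → n < p.2) : truncSingle n p = 0 := by
  rw [truncSingle, if_neg]
  rw [mem_basisIndex]
  rcases p with ⟨j, k⟩
  simp only [Prod.mk.injEq] at *
  rintro (h1 | ⟨h1, h2⟩ | ⟨h1, h2⟩)
  · omega
  · have := h' h1; omega
  · have := h' h1; omega

/-- The coordinates of the monomial `xᵃ yᵇ zᵏ` in the basis of the Milnor algebra. -/
noncomputable def normalForm (n a b k : ℕ) : Fin 3 × ℕ →₀ ℂ :=
  if (a + 2 * b) % 3 = 1 then truncSingle n (1, a + b + k - 1)
  else if (a + 2 * b) % 3 = 2 then truncSingle n (2, a + b + k - 1)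
  else truncSingle n (0, a + b + k) +
    if a = 0 ∧ b = 0 then 0 else ((n : ℂ) / 3) • truncSingle n (0, a + b + k + (n - 3))

lemma normalForm_zero_relation (n a b k : ℕ) :
    normalForm n (a + 2) b k = normalForm n a (b + 1) (k + 1) := by
  simp only [normalForm, show (a + 2 + 2 * b) % 3 = (a + 2 * (b + 1)) % 3 by omega,
    show a + 2 + b + k = a + (b + 1) + (k + 1) by omega]
  simp

lemma normalForm_one_relation (n a b k : ℕ) :
    normalForm n a (b + 2) k = normalForm n (a + 1) b (k + 1) := by
  simp only [normalForm, show (a + 2 * (b + 2)) % 3 = (a + 1 + 2 * b) % 3 by omega,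
    show a + (b + 2) + k = a + 1 + b + (k + 1) by omega]
  simp

lemma normalForm_two_relation {n : ℕ} (hn : 4 ≤ n) (a b k : ℕ) :
    (3 : ℂ) • normalForm n a b (k + 2) - (3 : ℂ) • normalForm n (a + 1) (b + 1) k +
      (n : ℂ) • normalForm n a b (k + (n - 1)) = 0 := by
  simp only [normalForm, show (a + 1 + 2 * (b + 1)) % 3 = (a + 2 * b) % 3 by omega,
    show a + 1 + (b + 1) + k = a + b + (k + 2) by omega,
    show ¬ (a + 1 = 0 ∧ b + 1 = 0) by omega, if_false]
  split_ifs with h1 h2 h3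
  · rw [truncSingle_eq_zero hn (p := (1, a + b + (k + (n - 1)) - 1)) (by grind) (by simp)]
    simp
  · rw [truncSingle_eq_zero hn (p := (2, a + b + (k + (n - 1)) - 1)) (by grind) (by simp)]
    simp
  · rw [show a + b + (k + 2) + (n - 3) = a + b + (k + (n - 1)) by omega]
    module
  · rw [show a + b + (k + 2) + (n - 3) = a + b + (k + (n - 1)) by omega,
      truncSingle_eq_zero hn (p := (0, a + b + (k + (n - 1)))) (by grind) (by grind),
      truncSingle_eq_zero hn (p := (0, a + b + (k + (n - 1)) + (n - 3))) (by grind) (by grind)]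
    simp

lemma normalForm_eq_zero {n : ℕ} (hn : 4 ≤ n) {a b k : ℕ} (h : n < a + b + k) :
    normalForm n a b k = 0 := by
  unfold normalForm
  split_ifs
  · exact truncSingle_eq_zero hn (by grind) (by simp)
  · exact truncSingle_eq_zero hn (by grind) (by simp)
  · rw [truncSingle_eq_zero hn (by grind) (by grind), zero_add]
  · rw [truncSingle_eq_zero hn (by grind) (by grind),
      truncSingle_eq_zero hn (by grind) (by grind), smul_zero, zero_add]

/-- `normalForm` as a function of the exponent vector. -/
noncomputable def normalFormFinsupp (n : ℕ) (m : Fin 3 →₀ ℕ) : Fin 3 × ℕ →₀ ℂ :=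
  normalForm n (m 0) (m 1) (m 2)

/-- The finite set of exponents that are at most `n` in each variable. -/
noncomputable def box (n : ℕ) : Finset (Fin 3 →₀ ℕ) :=
  Finset.Iic (Finsupp.equivFunOnFinite.symm fun _ => n)

lemma mem_box {n : ℕ} {m : Fin 3 →₀ ℕ} : m ∈ box n ↔ ∀ i, m i ≤ n := by
  simp [box, Finsupp.le_def]

lemma normalFormFinsupp_eq_zero {n : ℕ} (hn : 4 ≤ n) {m : Fin 3 →₀ ℕ} (hm : m ∉ box n) :
    normalFormFinsupp n m = 0 := by
  apply normalForm_eq_zero hn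
  rw [mem_box, Fin.forall_fin_succ, Fin.forall_fin_two] at hm
  change ¬ (m 0 ≤ n ∧ m 1 ≤ n ∧ m 2 ≤ n) at hm
  omega

/-- The linear map sending a power series to the coordinates of its class in the Milnor algebra. -/
noncomputable def coordMap (n : ℕ) : MvPowerSeries (Fin 3) ℂ →ₗ[ℂ] (Fin 3 × ℕ →₀ ℂ) :=
  ∑ m ∈ box n, (MvPowerSeries.coeff m).smulRight (normalFormFinsupp n m)

lemma coordMap_apply (n : ℕ) (g : MvPowerSeries (Fin 3) ℂ) :
    coordMap n g = ∑ m ∈ box n, MvPowerSeries.coeff m g • normalFormFinsupp n m := by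
  simp [coordMap]

lemma coordMap_mul_monomial {n : ℕ} (hn : 4 ≤ n) (g : MvPowerSeries (Fin 3) ℂ)
    (q : Fin 3 →₀ ℕ) (a : ℂ) :
    coordMap n (g * MvPowerSeries.monomial q a) =
      ∑ m ∈ box n, MvPowerSeries.coeff m g • a • normalFormFinsupp n (m + q) := by
  classical
  have hL : coordMap n (g * MvPowerSeries.monomial q a) = ∑ m ∈ box n with q ≤ m,
      (MvPowerSeries.coeff (m - q) g * a) • normalFormFinsupp n m := by
    rw [coordMap_apply, Finset.sum_filter]
    refine Finset.sum_congr rfl fun m _ => ?_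
    rw [MvPowerSeries.coeff_mul_monomial]
    split_ifs <;> simp
  have hR : ∑ m ∈ box n, MvPowerSeries.coeff m g • a • normalFormFinsupp n (m + q) =
      ∑ m ∈ box n with m + q ∈ box n,
        MvPowerSeries.coeff m g • a • normalFormFinsupp n (m + q) := by
    rw [Finset.sum_filter]
    refine Finset.sum_congr rfl fun m _ => ?_
    split_ifs with h
    · rfl
    · simp [normalFormFinsupp_eq_zero hn h]
  rw [hL, hR]
  refine Finset.sum_nbij' (· - q) (· + q) ?_ ?_ ?_ ?_ ?_
  · intro m hm
    simp only [Finset.mem_filter] at hm ⊢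
    rw [tsub_add_cancel_of_le hm.2]
    refine ⟨mem_box.2 fun i => ?_, hm.1⟩
    have := mem_box.1 hm.1 i
    simp only [Finsupp.tsub_apply]
    omega
  · intro m hm
    simp only [Finset.mem_filter] at hm ⊢
    exact ⟨hm.2, le_add_self⟩
  · intro m hm
    exact tsub_add_cancel_of_le (Finset.mem_filter.1 hm).2
  · intro m _
    exact add_tsub_cancel_right m q
  · intro m hm
    rw [tsub_add_cancel_of_le (Finset.mem_filter.1 hm).2, mul_smul]

/-- The ideal of power series generated by the partial derivatives of `poly n`. -/
noncomputable def jacobian (n : ℕ) : Ideal (MvPowerSeries (Fin 3) ℂ) :=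
  Ideal.span (Set.range fun i : Fin 3 => (pderiv i (poly n)).toMvPowerSeries)

lemma coe_pderiv_zero (n : ℕ) : (pderiv 0 (poly n)).toMvPowerSeries =
    3 * MvPowerSeries.X 0 ^ 2 - 3 * (MvPowerSeries.X 1 * MvPowerSeries.X 2) := by
  rw [← coeToMvPowerSeries.ringHom_apply, pderiv_zero_poly]
  simp only [map_sub, map_mul, map_pow, map_ofNat,
    coeToMvPowerSeries.ringHom_apply, coe_X]

lemma coe_pderiv_one (n : ℕ) : (pderiv 1 (poly n)).toMvPowerSeries =
    3 * MvPowerSeries.X 1 ^ 2 - 3 * (MvPowerSeries.X 0 * MvPowerSeries.X 2) := by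
  rw [← coeToMvPowerSeries.ringHom_apply, pderiv_one_poly]
  simp only [map_sub, map_mul, map_pow, map_ofNat,
    coeToMvPowerSeries.ringHom_apply, coe_X]

lemma coe_pderiv_two (n : ℕ) : (pderiv 2 (poly n)).toMvPowerSeries =
    3 * MvPowerSeries.X 2 ^ 2 - 3 * (MvPowerSeries.X 0 * MvPowerSeries.X 1) +
      (n : MvPowerSeries (Fin 3) ℂ) * MvPowerSeries.X 2 ^ (n - 1) := by
  rw [← coeToMvPowerSeries.ringHom_apply, pderiv_two_poly]
  simp only [map_sub, map_add, map_mul, map_pow, map_ofNat, map_natCast,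
    coeToMvPowerSeries.ringHom_apply, coe_X]

lemma jacobian_le_ker_coordMap {n : ℕ} (hn : 4 ≤ n) {g : MvPowerSeries (Fin 3) ℂ}
    (hg : g ∈ jacobian n) : coordMap n g = 0 := by
  have h3 : (3 : MvPowerSeries (Fin 3) ℂ) = MvPowerSeries.C 3 := (map_ofNat _ 3).symm
  have hn' : (n : MvPowerSeries (Fin 3) ℂ) = MvPowerSeries.C (n : ℂ) := (map_natCast _ n).symm
  have key : ∀ (i : Fin 3) (g : MvPowerSeries (Fin 3) ℂ),
      coordMap n (g * (pderiv i (poly n)).toMvPowerSeries) = 0 := by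
    intro i g
    fin_cases i
    · simp only [Fin.zero_eta, coe_pderiv_zero]
      rw [h3, MvPowerSeries.X_pow_eq, MvPowerSeries.X_def, MvPowerSeries.X_def,
        MvPowerSeries.monomial_mul_monomial, ← MvPowerSeries.smul_eq_C_mul,
        ← MvPowerSeries.smul_eq_C_mul, mul_sub, mul_smul_comm, mul_smul_comm, map_sub, map_smul,
        map_smul, coordMap_mul_monomial hn, coordMap_mul_monomial hn, ← smul_sub,
        ← Finset.sum_sub_distrib, Finset.sum_eq_zero, smul_zero]
      intro m _
      simp [normalFormFinsupp, normalForm_zero_relation]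
    · simp only [Fin.mk_one, coe_pderiv_one]
      rw [h3, MvPowerSeries.X_pow_eq, MvPowerSeries.X_def, MvPowerSeries.X_def,
        MvPowerSeries.monomial_mul_monomial, ← MvPowerSeries.smul_eq_C_mul,
        ← MvPowerSeries.smul_eq_C_mul, mul_sub, mul_smul_comm, mul_smul_comm, map_sub, map_smul,
        map_smul, coordMap_mul_monomial hn, coordMap_mul_monomial hn, ← smul_sub,
        ← Finset.sum_sub_distrib, Finset.sum_eq_zero, smul_zero]
      intro m _
      simp [normalFormFinsupp, normalForm_one_relation]
    · simp only [Fin.reduceFinMk, coe_pderiv_two]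
      rw [h3, hn', MvPowerSeries.X_pow_eq, MvPowerSeries.X_pow_eq, MvPowerSeries.X_def,
        MvPowerSeries.X_def, MvPowerSeries.monomial_mul_monomial, ← MvPowerSeries.smul_eq_C_mul,
        ← MvPowerSeries.smul_eq_C_mul, ← MvPowerSeries.smul_eq_C_mul, mul_add, mul_sub,
        mul_smul_comm, mul_smul_comm, mul_smul_comm, map_add, map_sub, map_smul, map_smul,
        map_smul, coordMap_mul_monomial hn, coordMap_mul_monomial hn, coordMap_mul_monomial hn,
        Finset.smul_sum, Finset.smul_sum, Finset.smul_sum,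
        ← Finset.sum_sub_distrib, ← Finset.sum_add_distrib, Finset.sum_eq_zero]
      intro m _
      have := congrArg (MvPowerSeries.coeff m g • ·)
        (normalForm_two_relation hn (m 0) (m 1) (m 2))
      simp only [smul_add, smul_sub, smul_zero] at this
      simpa [normalFormFinsupp, smul_comm (MvPowerSeries.coeff m g)] using this
  induction hg using Submodule.span_induction with
  | mem x hx =>
    obtain ⟨i, rfl⟩ := hx
    simpa using key i 1
  | zero => simp
  | add x y _ _ hx hy => rw [map_add, hx, hy, add_zero]
  | smul a x hx' hx =>
    clear hx
    induction hx' using Submodule.span_induction generalizing a with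
    | mem x hx =>
      obtain ⟨i, rfl⟩ := hx
      exact key i a
    | zero => simp
    | add x y _ _ hx hy => rw [smul_add, map_add, hx, hy, add_zero]
    | smul b x _ hx => rw [smul_smul]; exact hx _

/-- The Milnor algebra of `poly n` at the origin. -/
abbrev MilnorAlgebra (n : ℕ) : Type :=
  MvPowerSeries (Fin 3) ℂ ⧸ jacobian n

lemma smul_eq_mk_C_mul {n : ℕ} (a : ℂ) (u : MilnorAlgebra n) :
    a • u = Ideal.Quotient.mk (jacobian n) (MvPowerSeries.C a) * u :=
  Algebra.smul_def a u

/-- The class of the coordinate `X i` in the Milnor algebra. -/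
noncomputable def coord (n : ℕ) (i : Fin 3) : MilnorAlgebra n :=
  Ideal.Quotient.mk (jacobian n) (MvPowerSeries.X i)

lemma mk_coe_pderiv (n : ℕ) (i : Fin 3) :
    Ideal.Quotient.mk (jacobian n) (pderiv i (poly n)).toMvPowerSeries = 0 :=
  Ideal.Quotient.eq_zero_iff_mem.2 (Ideal.subset_span ⟨i, rfl⟩)

lemma eq_zero_of_natCast_mul {R : Type*} [CommRing R] [Algebra ℂ R] {m : ℕ} (hm : m ≠ 0) {u : R}
    (h : (m : R) * u = 0) : u = 0 := by
  rw [← map_natCast (algebraMap ℂ R), ← Algebra.smul_def] at h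
  exact (smul_eq_zero.1 h).resolve_left (by exact_mod_cast hm)

lemma coord_zero_sq (n : ℕ) : coord n 0 ^ 2 = coord n 1 * coord n 2 := by
  have h := mk_coe_pderiv n 0
  simp only [coe_pderiv_zero, map_sub, map_mul, map_pow, map_ofNat] at h
  refine sub_eq_zero.1 (eq_zero_of_natCast_mul (m := 3) (by norm_num) ?_)
  simp only [coord]
  push_cast
  linear_combination h

lemma coord_one_sq (n : ℕ) : coord n 1 ^ 2 = coord n 0 * coord n 2 := by
  have h := mk_coe_pderiv n 1
  simp only [coe_pderiv_one, map_sub, map_mul, map_pow, map_ofNat] at h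
  refine sub_eq_zero.1 (eq_zero_of_natCast_mul (m := 3) (by norm_num) ?_)
  simp only [coord]
  push_cast
  linear_combination h

lemma three_mul_coord_zero_mul_coord_one (n : ℕ) :
    3 * (coord n 0 * coord n 1) =
      3 * coord n 2 ^ 2 + (n : MilnorAlgebra n) * coord n 2 ^ (n - 1) := by
  have h := mk_coe_pderiv n 2
  simp only [coe_pderiv_two, map_add, map_sub, map_mul, map_pow, map_ofNat, map_natCast] at h
  simp only [coord]
  linear_combination -h

lemma coord_zero_mul_coord_one (n : ℕ) :
    coord n 0 * coord n 1 = coord n 2 ^ 2 + ((n : ℂ) / 3) • coord n 2 ^ (n - 1) := by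
  refine sub_eq_zero.1 (eq_zero_of_natCast_mul (m := 3) (by norm_num) ?_)
  have h : (3 : MilnorAlgebra n) *
      Ideal.Quotient.mk (jacobian n) (MvPowerSeries.C ((n : ℂ) / 3)) = n := by
    rw [← map_ofNat (Ideal.Quotient.mk (jacobian n)) 3, ← map_ofNat MvPowerSeries.C 3, ← map_mul,
      ← map_mul, mul_div_cancel₀ _ (by norm_num), map_natCast, map_natCast]
  rw [smul_eq_mk_C_mul]
  push_cast
  linear_combination three_mul_coord_zero_mul_coord_one n - coord n 2 ^ (n - 1) * h

lemma coord_zero_mul_pow {n : ℕ} (hn : n ≠ 0) : coord n 0 * coord n 2 ^ (n - 1) = 0 := by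
  refine eq_zero_of_natCast_mul hn ?_
  linear_combination -coord n 0 * three_mul_coord_zero_mul_coord_one n +
    3 * coord n 1 * coord_zero_sq n + 3 * coord n 2 * coord_one_sq n

lemma coord_one_mul_pow {n : ℕ} (hn : n ≠ 0) : coord n 1 * coord n 2 ^ (n - 1) = 0 := by
  refine eq_zero_of_natCast_mul hn ?_
  linear_combination -coord n 1 * three_mul_coord_zero_mul_coord_one n +
    3 * coord n 0 * coord_one_sq n + 3 * coord n 2 * coord_zero_sq n

lemma coord_two_pow {n : ℕ} (hn : 4 ≤ n) : coord n 2 ^ (n + 1) = 0 := by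
  have hu : IsUnit (3 + (n : MilnorAlgebra n) * coord n 2 ^ (n - 3)) := by
    have : IsUnit (3 + (n : MvPowerSeries (Fin 3) ℂ) * MvPowerSeries.X 2 ^ (n - 3)) := by
      rw [MvPowerSeries.isUnit_iff_constantCoeff]
      rw [map_add, map_mul, map_pow, MvPowerSeries.constantCoeff_X, zero_pow (by omega), mul_zero,
        add_zero, map_ofNat]
      norm_num
    simpa only [coord, map_add, map_mul, map_pow, map_ofNat, map_natCast] using this.map (Ideal.Quotient.mk (jacobian n))
  refine eq_zero_of_natCast_mul (m := n) (by omega) ?_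
  rw [← hu.mul_left_eq_zero]
  have h1 : coord n 2 ^ (n - 1) = coord n 2 ^ 2 * coord n 2 ^ (n - 3) := by
    rw [← pow_add]; congr 1; omega
  have h2 : coord n 2 ^ (n + 1) = coord n 2 ^ 4 * coord n 2 ^ (n - 3) := by
    rw [← pow_add]; congr 1; omega
  have h3 := three_mul_coord_zero_mul_coord_one n
  rw [h1] at h3
  rw [h2]
  linear_combination (-3 * coord n 0 * coord n 1 - n * (coord n 2 ^ 2 * coord n 2 ^ (n - 3))) * h3 +
    9 * coord n 1 ^ 2 * coord_zero_sq n + 9 * coord n 1 * coord n 2 * coord_one_sq n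

lemma coord_pow {n : ℕ} (hn : 4 ≤ n) (i : Fin 3) : coord n i ^ (2 * (n + 1)) = 0 := by
  fin_cases i
  · simp [pow_mul, coord_zero_sq, mul_pow, coord_two_pow hn]
  · simp [pow_mul, coord_one_sq, mul_pow, coord_two_pow hn]
  · simp [mul_comm 2, pow_mul, coord_two_pow hn]

/-- The monomials `zᵏ`, `x zᵏ`, `y zᵏ` in the Milnor algebra. -/
noncomputable def basisMonomial (n : ℕ) (p : Fin 3 × ℕ) : MilnorAlgebra n :=
  ![1, coord n 0, coord n 1] p.1 * coord n 2 ^ p.2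

lemma basisMonomial_eq_zero {n : ℕ} (hn : 4 ≤ n) {p : Fin 3 × ℕ} (hp : p ∉ basisIndex n) :
    basisMonomial n p = 0 := by
  obtain ⟨j, k⟩ := p
  simp only [mem_basisIndex, Prod.mk.injEq, not_or, not_and, not_lt] at hp
  obtain ⟨hk, h1, h2⟩ := hp
  obtain ⟨l, rfl⟩ := Nat.exists_eq_add_of_le hk
  fin_cases j
  · obtain ⟨l', hl'⟩ : ∃ l', n - 1 + l = n + 1 + l' := by
      refine Nat.exists_eq_add_of_le ?_
      have := h1 rfl
      have := h2 rfl
      omega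
    simp [basisMonomial, hl', pow_add _ (n + 1), coord_two_pow hn]
  · simp [basisMonomial, pow_add, ← mul_assoc, coord_zero_mul_pow (show n ≠ 0 by omega)]
  · simp [basisMonomial, pow_add, ← mul_assoc, coord_one_mul_pow (show n ≠ 0 by omega)]

lemma coord_mul_basisMonomial_mem (n : ℕ) (i : Fin 3) (p : Fin 3 × ℕ) :
    coord n i * basisMonomial n p ∈ Submodule.span ℂ (Set.range (basisMonomial n)) := by
  have hmem : ∀ q, basisMonomial n q ∈ Submodule.span ℂ (Set.range (basisMonomial n)) :=
    fun q => Submodule.subset_span ⟨q, rfl⟩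
  have hxy : ∀ k, coord n 0 * coord n 1 * coord n 2 ^ k ∈
      Submodule.span ℂ (Set.range (basisMonomial n)) := by
    intro k
    convert Submodule.add_mem _ (hmem (0, 2 + k))
      (Submodule.smul_mem _ ((n : ℂ) / 3) (hmem (0, n - 1 + k))) using 1
    simp only [basisMonomial, coord_zero_mul_coord_one, smul_eq_mk_C_mul, Matrix.cons_val, pow_add]
    ring
  have hz : ∀ j k, coord n 2 * basisMonomial n (j, k) ∈
      Submodule.span ℂ (Set.range (basisMonomial n)) := by
    intro j k
    convert hmem (j, k + 1) using 1
    simp only [basisMonomial]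
    ring
  obtain ⟨j, k⟩ := p
  fin_cases i <;> fin_cases j
  · convert hmem (1, k) using 1
    simp [basisMonomial]
  · convert hmem (2, k + 1) using 1
    simp only [basisMonomial, Fin.zero_eta, Fin.mk_one, Matrix.cons_val]
    linear_combination coord n 2 ^ k * coord_zero_sq n
  · convert hxy k using 1
    simp [basisMonomial, mul_assoc]
  · convert hmem (2, k) using 1
    simp [basisMonomial]
  · convert hxy k using 1
    simp only [basisMonomial, Fin.mk_one, Matrix.cons_val]
    ring
  · convert hmem (1, k + 1) using 1
    simp only [basisMonomial, Fin.reduceFinMk, Fin.mk_one, Matrix.cons_val]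
    linear_combination coord n 2 ^ k * coord_one_sq n
  all_goals exact hz _ _

lemma mk_coe_mem_span (n : ℕ) (p : MvPolynomial (Fin 3) ℂ) :
    Ideal.Quotient.mk (jacobian n) p.toMvPowerSeries ∈
      Submodule.span ℂ (Set.range (basisMonomial n)) := by
  have hmul : ∀ i, ∀ w ∈ Submodule.span ℂ (Set.range (basisMonomial n)),
      coord n i * w ∈ Submodule.span ℂ (Set.range (basisMonomial n)) := by
    intro i w hw
    induction hw using Submodule.span_induction with
    | mem w hw =>
      obtain ⟨p, rfl⟩ := hw
      exact coord_mul_basisMonomial_mem n i p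
    | zero => simp
    | add u v _ _ hu hv => rw [mul_add]; exact Submodule.add_mem _ hu hv
    | smul a u _ hu => rw [mul_smul_comm]; exact Submodule.smul_mem _ a hu
  induction p using MvPolynomial.induction_on with
  | C a =>
    have h1 : basisMonomial n (0, 0) = 1 := by simp [basisMonomial]
    have : Ideal.Quotient.mk (jacobian n) (C a : MvPolynomial (Fin 3) ℂ).toMvPowerSeries =
        a • basisMonomial n (0, 0) := by
      rw [h1, smul_eq_mk_C_mul, mul_one, coe_C]
    rw [this]
    exact Submodule.smul_mem _ _ (Submodule.subset_span ⟨_, rfl⟩)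
  | add p q hp hq => rw [coe_add, map_add]; exact Submodule.add_mem _ hp hq
  | mul_X p i hp =>
    rw [coe_mul, map_mul, coe_X, mul_comm]
    exact hmul i _ hp

lemma mem_of_coeff_eq_zero {I : Ideal (MvPowerSeries (Fin 3) ℂ)} {M : ℕ}
    (hI : ∀ i, MvPowerSeries.X i ^ M ∈ I) {g : MvPowerSeries (Fin 3) ℂ}
    (hg : ∀ m : Fin 3 →₀ ℕ, (∀ i, m i < M) → MvPowerSeries.coeff m g = 0) : g ∈ I := by
  classical
  have hmem : ∀ (i : Fin 3) (P : (Fin 3 →₀ ℕ) → Prop), (∀ m, P m → M ≤ m i) →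
      ∃ h ∈ I, ∀ m, MvPowerSeries.coeff m h = if P m then MvPowerSeries.coeff m g else 0 := by
    intro i P hP
    refine ⟨fun m => if P m then MvPowerSeries.coeff m g else 0,
      I.mem_of_dvd (MvPowerSeries.X_pow_dvd_iff.2 fun m hm => ?_) (hI i), fun m => rfl⟩
    exact if_neg fun h => hm.not_ge (hP m h)
  obtain ⟨g0, h0, e0⟩ := hmem 0 (fun m => M ≤ m 0) fun m hm => hm
  obtain ⟨g1, h1, e1⟩ := hmem 1 (fun m => m 0 < M ∧ M ≤ m 1) fun m hm => hm.2
  obtain ⟨g2, h2, e2⟩ := hmem 2 (fun m => m 0 < M ∧ m 1 < M ∧ M ≤ m 2) fun m hm => hm.2.2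
  convert I.add_mem (I.add_mem h0 h1) h2 using 1
  ext m
  have := hg m
  rw [Fin.forall_fin_succ, Fin.forall_fin_two] at this
  change m 0 < M ∧ m 1 < M ∧ m 2 < M → _ at this
  rw [map_add, map_add, e0, e1, e2]
  by_cases hm0 : M ≤ m 0
  · simp [hm0, hm0.not_gt]
  · by_cases hm1 : M ≤ m 1
    · simp [hm0, hm1, hm1.not_gt, not_le.1 hm0]
    · by_cases hm2 : M ≤ m 2
      · simp [hm0, hm1, hm2, not_le.1 hm0, not_le.1 hm1]
      · simp [hm0, hm1, hm2, this ⟨not_le.1 hm0, not_le.1 hm1, not_le.1 hm2⟩]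

lemma span_range_basisMonomial {n : ℕ} (hn : 4 ≤ n) :
    Submodule.span ℂ (Set.range (basisMonomial n)) = ⊤ := by
  refine eq_top_iff.2 fun q _ => ?_
  obtain ⟨g, rfl⟩ := Ideal.Quotient.mk_surjective q
  have h : g - (MvPowerSeries.truncFinset ℂ (box (2 * (n + 1))) g).toMvPowerSeries ∈
      jacobian n := by
    refine mem_of_coeff_eq_zero (M := 2 * (n + 1)) (fun i => ?_) fun m hm => ?_
    · rw [← Ideal.Quotient.eq_zero_iff_mem, map_pow]
      exact coord_pow hn i
    · rw [map_sub, coeff_coe, MvPowerSeries.coeff_truncFinset_of_mem, sub_self]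
      exact mem_box.2 fun i => (hm i).le
  rw [Ideal.Quotient.eq.2 h]
  exact mk_coe_mem_span n _

lemma span_range_basisMonomial_restrict {n : ℕ} (hn : 4 ≤ n) :
    Submodule.span ℂ (Set.range fun p : basisIndex n => basisMonomial n p) = ⊤ := by
  rw [eq_top_iff, ← span_range_basisMonomial hn, Submodule.span_le]
  rintro _ ⟨p, rfl⟩
  by_cases hp : p ∈ basisIndex n
  · exact Submodule.subset_span ⟨⟨p, hp⟩, rfl⟩
  · rw [basisMonomial_eq_zero hn hp]
    exact Submodule.zero_mem _

/-- The coordinates of an element of the Milnor algebra. -/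
noncomputable def quotientCoordMap {n : ℕ} (hn : 4 ≤ n) :
    MilnorAlgebra n →ₗ[ℂ] (Fin 3 × ℕ →₀ ℂ) :=
  ((jacobian n).restrictScalars ℂ).liftQ (coordMap n) fun _ hg => jacobian_le_ker_coordMap hn hg

lemma coordMap_monomial {n : ℕ} (hn : 4 ≤ n) (m : Fin 3 →₀ ℕ) :
    coordMap n (MvPowerSeries.monomial m 1) = normalFormFinsupp n m := by
  classical
  rw [coordMap_apply, Finset.sum_eq_single m]
  · simp
  · intro b _ hb
    rw [MvPowerSeries.coeff_monomial_ne hb, zero_smul]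
  · intro h
    rw [normalFormFinsupp_eq_zero hn h, smul_zero]

lemma quotientCoordMap_basisMonomial {n : ℕ} (hn : 4 ≤ n) {p : Fin 3 × ℕ}
    (hp : p ∈ basisIndex n) :
    quotientCoordMap hn (basisMonomial n p) = Finsupp.single p 1 := by
  obtain ⟨j, k⟩ := p
  have key : ∀ m : Fin 3 →₀ ℕ, basisMonomial n (j, k) =
      Ideal.Quotient.mk (jacobian n) (MvPowerSeries.monomial m 1) →
      normalFormFinsupp n m = Finsupp.single (j, k) 1 →
      quotientCoordMap hn (basisMonomial n (j, k)) = Finsupp.single (j, k) 1 := by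
    intro m h1 h2
    rw [h1, ← h2, ← coordMap_monomial hn]
    rfl
  have hE : truncSingle n (j, k) = Finsupp.single (j, k) 1 := if_pos hp
  fin_cases j
  · refine key (Finsupp.single 2 k) ?_ ?_
    · simp [basisMonomial, coord, ← map_pow, MvPowerSeries.X_pow_eq]
    · simpa [normalFormFinsupp, normalForm] using hE
  · refine key (Finsupp.single 0 1 + Finsupp.single 2 k) ?_ ?_
    · simp only [basisMonomial, coord, ← map_pow, MvPowerSeries.X_pow_eq, Fin.mk_one, Matrix.cons_val,
        ← map_mul]
      rw [MvPowerSeries.X_def, MvPowerSeries.monomial_mul_monomial, mul_one]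
    · simpa [normalFormFinsupp, normalForm] using hE
  · refine key (Finsupp.single 1 1 + Finsupp.single 2 k) ?_ ?_
    · simp only [basisMonomial, coord, ← map_pow, MvPowerSeries.X_pow_eq, Fin.reduceFinMk, Matrix.cons_val,
        ← map_mul]
      rw [MvPowerSeries.X_def, MvPowerSeries.monomial_mul_monomial, mul_one]
    · simpa [normalFormFinsupp, normalForm] using hE

lemma linearIndependent_basisMonomial {n : ℕ} (hn : 4 ≤ n) :
    LinearIndependent ℂ fun p : basisIndex n => basisMonomial n p := by
  refine LinearIndependent.of_comp (quotientCoordMap hn) ?_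
  have : (quotientCoordMap hn ∘ fun p : basisIndex n => basisMonomial n p) =
      (fun p => Finsupp.single p (1 : ℂ)) ∘ ((↑) : basisIndex n → Fin 3 × ℕ) := by
    funext p
    exact quotientCoordMap_basisMonomial hn p.2
  rw [this]
  exact (Finsupp.linearIndependent_single_one ℂ _).comp _ Subtype.val_injective

lemma finrank_milnorAlgebra {n : ℕ} (hn : 4 ≤ n) :
    Module.finrank ℂ (MilnorAlgebra n) = 3 * n - 1 := by
  rw [Module.finrank_eq_card_basis (Module.Basis.mk (linearIndependent_basisMonomial hn)
    (span_range_basisMonomial_restrict hn).ge), Fintype.card_coe, card_basisIndex hn]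

end CubicPlusPow

/-- For every `n ≥ 4`, the polynomial `fₙ = x³ + y³ + z³ − 3xyz + zⁿ` has an isolated critical
point at the origin and Milnor number `μ(fₙ) = 3n − 1`. -/
theorem milnor_number_of_cubic_plus_zn (n : ℕ) (hn : 4 ≤ n)
    (f : MvPolynomial (Fin 3) ℂ)
    (hf : f = X 0 ^ 3 + X 1 ^ 3 + X 2 ^ 3 - 3 * X 0 * X 1 * X 2 + X 2 ^ n) :
    HasIsolatedCriticalPointAtOrigin f ∧ milnorNumber f = 3 * n - 1 := by
  subst hf
  exact ⟨CubicPlusPow.hasIsolatedCriticalPointAtOrigin_poly hn,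
    CubicPlusPow.finrank_milnorAlgebra hn⟩
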